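/- Let (X, h, Z) be a fiberwise essentially minimal zero-dimensional system with associated map ψ : X → Z. Then the restriction map f ↦ f|_Z is an isomorphism of additive groups from { f ∈ C(X, ℤ) : f ∘ h⁻¹ = f } onto C(Z, ℤ), where C(X, ℤ) and C(Z, ℤ) denote the additive groups of continuous ℤ-valued functions on X and Z respectively. In particular, the kernel of the endomorphism id − α of C(X, ℤ), where α(f) = f ∘ h⁻¹, is isomorphic to C(Z, ℤ). -/

import Mathlib

open Set

/-- A minimal set for the restriction of the homeomorphism `h` to the invariant set `A`:
a nonempty closed `h`-invariant subset of `A` with no nonempty proper closed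
`h`-invariant subset. -/
def IsMinimalSubsetOf {X : Type*} [TopologicalSpace X] (h : X ≃ₜ X) (A Y : Set X) : Prop :=
  Y.Nonempty ∧ IsClosed Y ∧ Y ⊆ A ∧ h '' Y = Y ∧
    ∀ Y' ⊆ Y, Y'.Nonempty → IsClosed Y' → h '' Y' = Y' → Y' = Y

/-- `(X, h, Z)` is a fiberwise essentially minimal zero-dimensional system with
associated map `ψ`. -/
def IsFiberwiseEssentiallyMinimal {X : Type*} [TopologicalSpace X] (h : X ≃ₜ X)
    (Z : Set X) (ψ : X → X) : Prop :=
  IsClosed Z ∧ Continuous ψ ∧ (∀ x, ψ x ∈ Z) ∧ (∀ z ∈ Z, ψ z = z) ∧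
    (∀ x, ψ (h x) = ψ x) ∧
    ∀ z ∈ Z, ∃ Y, IsMinimalSubsetOf h (ψ ⁻¹' {z}) Y ∧ z ∈ Y ∧
      ∀ Y', IsMinimalSubsetOf h (ψ ⁻¹' {z}) Y' → Y' = Y

/-- The additive group homomorphism `id - α` on `C(X, ℤ)`, where `α(f) = f ∘ h⁻¹`. -/
noncomputable def coboundary {X : Type*} [TopologicalSpace X] (h : X ≃ₜ X) :
    C(X, ℤ) →+ C(X, ℤ) where
  toFun f := f - f.comp (h.symm : C(X, X))
  map_zero' := by ext x; simp
  map_add' f g := by ext x; simp; ring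

/-- `K⁰(X, h)`: the quotient of `C(X, ℤ)` by the image of `id - α`. -/
noncomputable def K0 {X : Type*} [TopologicalSpace X] (h : X ≃ₜ X) :=
  C(X, ℤ) ⧸ (coboundary h).range

noncomputable instance {X : Type*} [TopologicalSpace X] (h : X ≃ₜ X) :
    AddCommGroup (K0 h) :=
  inferInstanceAs (AddCommGroup (C(X, ℤ) ⧸ (coboundary h).range))

/-- The quotient map `π : C(X, ℤ) → K⁰(X, h)`. -/
noncomputable def K0pi {X : Type*} [TopologicalSpace X] (h : X ≃ₜ X) :
    C(X, ℤ) →+ K0 h :=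
  QuotientAddGroup.mk' (coboundary h).range

/-- The positive cone `K⁰(X, h)⁺`, the image of the pointwise nonnegative functions. -/
noncomputable def K0pos {X : Type*} [TopologicalSpace X] (h : X ≃ₜ X) : Set (K0 h) :=
  K0pi h '' { f : C(X, ℤ) | ∀ x, 0 ≤ f x }

/-- Every nonempty closed invariant set of a homeomorphism of a compact space contains a
minimal set. -/
theorem exists_isMinimalSubsetOf {X : Type*} [TopologicalSpace X] [CompactSpace X]
    (h : X ≃ₜ X) {A : Set X} (hne : A.Nonempty) (hcl : IsClosed A) (hinv : h '' A = A) :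
    ∃ Y, IsMinimalSubsetOf h A Y := by
  obtain ⟨Y, hYA, ⟨hYne, hYcl, hYinv⟩, hYmin⟩ :=
    zorn_superset_nonempty {Y : Set X | Y.Nonempty ∧ IsClosed Y ∧ h '' Y = Y}
      (by
        intro c hc hchain hcne
        have : Nonempty c := hcne.to_subtype
        refine ⟨⋂₀ c, ⟨?_, isClosed_sInter fun s hs => (hc hs).2.1, ?_⟩,
          fun s hs => sInter_subset_of_mem hs⟩
        · exact IsCompact.nonempty_sInter_of_directed_nonempty_isCompact_isClosed
            (IsChain.directedOn hchain.symm) (fun s hs => (hc hs).1)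
            (fun s hs => (hc hs).2.1.isCompact) (fun s hs => (hc hs).2.1)
        · rw [sInter_eq_biInter, image_iInter₂ h.bijective]
          exact iInter₂_congr fun s hs => (hc hs).2.2)
      A ⟨hne, hcl, hinv⟩
  exact ⟨Y, hYne, hYcl, hYA, hYinv, fun Y' hY' hne' hcl' hinv' =>
    hY'.antisymm (hYmin ⟨hne', hcl', hinv'⟩ hY')⟩

/-- A set defined by an `h`-invariant condition is mapped onto itself by `h`. -/
theorem Homeomorph.image_eq_of_mem_iff {X : Type*} [TopologicalSpace X] (h : X ≃ₜ X)
    {A : Set X} (hA : ∀ x, h x ∈ A ↔ x ∈ A) : h '' A = A := by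
  have hpre : h ⁻¹' A = A := Set.ext hA
  simpa only [hpre] using image_preimage_eq A h.surjective

theorem IsFiberwiseEssentiallyMinimal.apply_eq {X : Type*} [TopologicalSpace X]
    [CompactSpace X] [T1Space X] {h : X ≃ₜ X} {Z : Set X} {ψ : X → X}
    (hfem : IsFiberwiseEssentiallyMinimal h Z ψ) {f : X → ℤ} (hf : Continuous f)
    (hinv : ∀ x, f (h x) = f x) (x : X) : f (ψ x) = f x := by
  obtain ⟨-, hψ, hψZ, -, hψh, hmin⟩ := hfem
  obtain ⟨Y, -, hzY, huniq⟩ := hmin (ψ x) (hψZ x)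
  obtain ⟨Y', hne, hcl, hsub, hY'inv, hY'min⟩ := exists_isMinimalSubsetOf h
    (A := ψ ⁻¹' {ψ x} ∩ f ⁻¹' {f x}) ⟨x, rfl, rfl⟩
    ((isClosed_singleton.preimage hψ).inter (isClosed_singleton.preimage hf))
    (h.image_eq_of_mem_iff fun y => by simp [hψh, hinv])
  obtain rfl := huniq Y' ⟨hne, hcl, hsub.trans inter_subset_left, hY'inv, hY'min⟩
  exact (hsub hzY).2

theorem ContinuousMap.comp_symm_eq_iff {X Y : Type*} [TopologicalSpace X] [TopologicalSpace Y]
    (h : X ≃ₜ X) (f : C(X, Y)) :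
    f.comp (h.symm : C(X, X)) = f ↔ ∀ x, f (h x) = f x := by
  refine ⟨fun hf x => ?_, fun hf => ?_⟩
  · simpa using (DFunLike.congr_fun hf (h x)).symm
  · ext x
    simpa using (hf (h.symm x)).symm

theorem mem_ker_coboundary_iff {X : Type*} [TopologicalSpace X] (h : X ≃ₜ X) (f : C(X, ℤ)) :
    f ∈ (coboundary h).ker ↔ f.comp (h.symm : C(X, X)) = f := by
  rw [AddMonoidHom.mem_ker, eq_comm (b := f)]
  exact sub_eq_zero

theorem IsFiberwiseEssentiallyMinimal.bijective_restrict {X : Type*} [TopologicalSpace X]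
    [CompactSpace X] [T1Space X] {h : X ≃ₜ X} {Z : Set X} {ψ : X → X}
    (hfem : IsFiberwiseEssentiallyMinimal h Z ψ) :
    Function.Bijective
      (fun f : { f : C(X, ℤ) // f.comp (h.symm : C(X, X)) = f } =>
        ContinuousMap.restrict Z (f : C(X, ℤ))) := by
  have ⟨_, hψ, hψZ, hψid, hψh, _⟩ := hfem
  refine ⟨?_, fun g => ?_⟩
  · rintro ⟨f, hf⟩ ⟨g, hg⟩ hfg
    rw [ContinuousMap.comp_symm_eq_iff] at hf hg
    ext x
    rw [← hfem.apply_eq f.continuous hf, ← hfem.apply_eq g.continuous hg]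
    exact DFunLike.congr_fun hfg ⟨ψ x, hψZ x⟩
  · refine ⟨⟨g.comp ⟨fun x => ⟨ψ x, hψZ x⟩, hψ.subtype_mk hψZ⟩, ?_⟩, ?_⟩
    · rw [ContinuousMap.comp_symm_eq_iff]
      intro x
      simp [hψh]
    · ext ⟨z, hz⟩
      simp [hψid z hz]

/-- The restriction map `f ↦ f|_Z` is an additive group isomorphism from the group of
`h`-invariant continuous `ℤ`-valued functions on `X` onto `C(Z, ℤ)`; in particular the
kernel of `id - α` is isomorphic to `C(Z, ℤ)`. -/
theorem stmt5 {X : Type*} [TopologicalSpace X] [CompactSpace X]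
    [TopologicalSpace.MetrizableSpace X] [TotallyDisconnectedSpace X]
    (h : X ≃ₜ X) (Z : Set X) (ψ : X → X)
    (hfem : IsFiberwiseEssentiallyMinimal h Z ψ) :
    (∀ f g : C(X, ℤ), ContinuousMap.restrict Z (f + g)
        = ContinuousMap.restrict Z f + ContinuousMap.restrict Z g) ∧
    Function.Bijective
      (fun f : { f : C(X, ℤ) // f.comp (h.symm : C(X, X)) = f } =>
        ContinuousMap.restrict Z (f : C(X, ℤ))) ∧
    Nonempty ((coboundary h).ker ≃+ C(Z, ℤ)) := by
  refine ⟨fun _ _ => rfl, hfem.bijective_restrict, ⟨AddEquiv.ofBijective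
    (AddMonoidHom.mk' (fun f : (coboundary h).ker => ContinuousMap.restrict Z (f : C(X, ℤ)))
      fun _ _ => rfl) ?_⟩⟩
  exact hfem.bijective_restrict.comp
    (Equiv.subtypeEquivRight (mem_ker_coboundary_iff h)).bijective
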